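/- Let w be a finite word with |Alph(w)| ≥ 2. Then |w| + 2 = R_w + K_w + |Alph(w)| if and only if for every non-negative integer i < R_w there exists exactly one right special factor of w of length i, and every nonempty right special factor of w has right-valence exactly 2. -/

import Mathlib

open List

variable {A : Type*} [DecidableEq A]

/-- The alphabet of a word: the finite set of distinct letters occurring in it. -/
def Alph (w : List A) : Finset A := w.toFinset

/-- The finset of all factors (contiguous subwords) of `w`. -/
def factors (w : List A) : Finset (List A) :=
  ((Finset.range (w.length + 1)) ×ˢ (Finset.range (w.length + 1))).image
    (fun p => (w.drop p.1).take p.2)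

/-- Factor complexity: the number of distinct factors of `w` of length `n`. -/
def C (w : List A) (n : ℕ) : ℕ := ((factors w).filter (fun u => u.length = n)).card

/-- Right-valence of `u` in `w`: the number of distinct letters `x` such that `u ++ [x]`
is a factor of `w`. -/
def rightValence (w u : List A) : ℕ := ((Alph w).filter (fun x => u ++ [x] <:+: w)).card

/-- `u` is a right special factor of `w`. -/
def RightSpecial (w u : List A) : Prop := u <:+: w ∧ 2 ≤ rightValence w u

/-- `R w`: the smallest positive integer `r` such that `w` has no right special factor
of length `r`. -/
noncomputable def R (w : List A) : ℕ :=
  sInf {r : ℕ | 0 < r ∧ ∀ u : List A, u.length = r → ¬ RightSpecial w u}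

/-- The number of occurrences of `u` as a factor of `w`. -/
def occCount (w u : List A) : ℕ :=
  ((Finset.range (w.length + 1)).filter
    (fun i => i + u.length ≤ w.length ∧ (w.drop i).take u.length = u)).card

/-- `K w`: the length of the shortest suffix of `w` occurring exactly once in `w`. -/
noncomputable def K (w : List A) : ℕ :=
  sInf {k : ℕ | ∃ u : List A, u <:+ w ∧ u.length = k ∧ occCount w u = 1}

/-- Left-valence of `u` in `w`. -/
def leftValence (w u : List A) : ℕ := ((Alph w).filter (fun x => x :: u <:+: w)).card

/-- `u` is a left special factor of `w`. -/
def LeftSpecial (w u : List A) : Prop := u <:+: w ∧ 2 ≤ leftValence w u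

/-- `L w`: the smallest positive integer `ℓ` such that `w` has no left special factor
of length `ℓ`. -/
noncomputable def L (w : List A) : ℕ :=
  sInf {r : ℕ | 0 < r ∧ ∀ u : List A, u.length = r → ¬ LeftSpecial w u}

/-- `H w`: the length of the shortest prefix of `w` occurring exactly once in `w`. -/
noncomputable def H (w : List A) : ℕ :=
  sInf {k : ℕ | ∃ u : List A, u <+: w ∧ u.length = k ∧ occCount w u = 1}

/-- A generalized trapezoidal word. -/
def IsGT (w : List A) : Prop :=
  w ≠ [] ∧ ((Alph w).card = 1 ∨
    ∃ m M : ℕ, 0 < m ∧ m ≤ M ∧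
      (∀ i, 1 ≤ i → i ≤ m → C w i = (Alph w).card + i - 1) ∧
      (∀ i, m ≤ i → i ≤ M - 1 → C w (i + 1) = C w i) ∧
      (∀ i, M ≤ i → i ≤ w.length → C w (i + 1) = C w i - 1))

/-- The heart of a word: remove the longest prefix and longest suffix consisting of
letters that occur exactly once in the word (if some letter repeats); otherwise the
word itself. -/
def heart (w : List A) : List A :=
  if ∀ x ∈ w, w.count x = 1 then w
  else
    ((w.dropWhile (fun x => w.count x == 1)).reverse.dropWhile
      (fun x => w.count x == 1)).reverse

/-- A word is rich if it has exactly `|w| + 1` distinct palindromic factors. -/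
def Rich (w : List A) : Prop :=
  ((factors w).filter (fun u => u.reverse = u)).card = w.length + 1

/-- `p` is a period of `w`. -/
def IsPeriod (w : List A) (p : ℕ) : Prop :=
  0 < p ∧ ∀ i : ℕ, i + p < w.length → w[i]? = w[i + p]?

/-- The minimal period of `w`. -/
noncomputable def minPeriod (w : List A) : ℕ := sInf {p : ℕ | IsPeriod w p}

theorem mem_factors' (w u : List A) : u ∈ factors w ↔ u <:+: w := by
  unfold factors
  simp only [Finset.mem_image, Finset.mem_product, Finset.mem_range, Prod.exists]
  constructor
  · rintro ⟨a, b, -, rfl⟩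
    exact (List.take_prefix _ _).isInfix.trans (List.drop_suffix _ _).isInfix
  · rintro ⟨s, t, rfl⟩
    refine ⟨s.length, u.length, ⟨?_, ?_⟩, ?_⟩
    · simp only [List.length_append]; omega
    · simp only [List.length_append]; omega
    · simp

theorem rv_mem (w u : List A) (x : A) :
    x ∈ (Alph w).filter (fun x => u ++ [x] <:+: w) ↔ u ++ [x] <:+: w := by
  simp only [Finset.mem_filter, Alph, List.mem_toFinset, and_iff_right_iff_imp]
  intro h
  exact h.subset (by simp)

theorem rv_zero (w u : List A) : rightValence w u = 0 ↔ ∀ s t, s ++ u ++ t = w → t = [] := by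
  unfold rightValence
  rw [Finset.card_eq_zero, Finset.eq_empty_iff_forall_notMem]
  simp only [rv_mem]
  constructor
  · intro h s t e
    cases t with
    | nil => rfl
    | cons x t => exact absurd ⟨s, t, by simp [← e]⟩ (h x)
  · rintro h x ⟨s, t, e⟩
    have := h s (x :: t) (by simp [← e])
    simp at this

theorem rv_mono (w u v : List A) (h : v <:+ u) : rightValence w u ≤ rightValence w v := by
  unfold rightValence
  apply Finset.card_le_card
  intro x
  rw [rv_mem, rv_mem]
  intro h'
  obtain ⟨p, rfl⟩ := h
  refine List.IsInfix.trans ?_ h'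
  exact ⟨p, [], by simp⟩

theorem occ_one (w u : List A) (hu : u <:+ w) : occCount w u = 1 ↔ rightValence w u = 0 := by
  rw [rv_zero]
  unfold occCount
  obtain ⟨p, hp⟩ := hu
  have hpl : p.length + u.length = w.length := by simp [← hp]
  have hm : p.length ∈ (Finset.range (w.length + 1)).filter
    (fun i => i + u.length ≤ w.length ∧ (w.drop i).take u.length = u) := by
    simp only [Finset.mem_filter, Finset.mem_range]
    refine ⟨by omega, by omega, ?_⟩
    simp [← hp]
  constructor
  · intro h s t e
    rw [Finset.card_eq_one] at h
    obtain ⟨a, ha⟩ := h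
    have hs : s.length ∈ (Finset.range (w.length + 1)).filter
      (fun i => i + u.length ≤ w.length ∧ (w.drop i).take u.length = u) := by
      have : s.length + u.length + t.length = w.length := by simp [← e]; omega
      simp only [Finset.mem_filter, Finset.mem_range]
      refine ⟨by omega, by omega, ?_⟩
      simp [← e]
    rw [ha, Finset.mem_singleton] at hm hs
    have : s.length + u.length + t.length = w.length := by simp [← e]; omega
    exact List.length_eq_zero_iff.1 (by omega)
  · intro h
    rw [Finset.card_eq_one]
    refine ⟨p.length, ?_⟩
    ext i
    rw [Finset.mem_singleton]
    constructor
    · simp only [Finset.mem_filter, Finset.mem_range]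
      rintro ⟨-, h1, h3⟩
      have e : w.take i ++ u ++ (w.drop i).drop u.length = w := by
        have h4 := List.take_append_drop u.length (w.drop i)
        rw [h3] at h4
        rw [List.append_assoc, h4, List.take_append_drop]
      have := congrArg List.length (h _ _ e)
      simp at this
      omega
    · rintro rfl; exact hm

theorem sum_rv (w : List A) : (factors w).card = 1 + ∑ u ∈ factors w, rightValence w u := by
  have h0 : [] ∈ factors w := by rw [mem_factors']; exact List.nil_infix
  rw [← Finset.card_erase_add_one h0, add_comm]
  congr 1
  unfold rightValence
  rw [← Finset.card_sigma]
  symm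
  refine Finset.card_bij (fun p _ => p.1 ++ [p.2]) ?_ ?_ ?_
  · rintro ⟨u, x⟩ h
    rw [Finset.mem_sigma, rv_mem] at h
    rw [Finset.mem_erase, mem_factors']
    exact ⟨by simp, h.2⟩
  · rintro ⟨u, x⟩ - ⟨v, y⟩ - h
    have := List.append_inj' h rfl
    simp at this
    obtain ⟨rfl, rfl⟩ := this
    rfl
  · intro b hb
    rw [Finset.mem_erase, mem_factors'] at hb
    rcases List.eq_nil_or_concat b with h | ⟨u, x, rfl⟩
    · exact absurd h hb.1
    · refine ⟨⟨u, x⟩, ?_, by simp⟩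
      rw [Finset.mem_sigma, rv_mem, mem_factors']
      simp only [List.concat_eq_append] at hb
      exact ⟨List.IsInfix.trans ⟨[], [x], by simp⟩ hb.2, hb.2⟩

theorem K_spec (w : List A) : K w ≤ w.length ∧
    ∀ u, u <:+ w → (rightValence w u = 0 ↔ K w ≤ u.length) := by
  have hw : w.length ∈ {k : ℕ | ∃ u : List A, u <:+ w ∧ u.length = k ∧ occCount w u = 1} := by
    refine ⟨w, List.suffix_rfl, rfl, ?_⟩
    rw [occ_one _ _ List.suffix_rfl, rv_zero]
    intro s t e
    have := congrArg List.length e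
    simp at this
    exact List.length_eq_zero_iff.1 (by omega)
  refine ⟨Nat.sInf_le hw, fun u hu => ⟨fun h => Nat.sInf_le ⟨u, hu, rfl, (occ_one _ _ hu).2 h⟩, ?_⟩⟩
  intro h
  obtain ⟨v, hv, hl, ho⟩ := Nat.sInf_mem ⟨_, hw⟩
  rw [occ_one _ _ hv] at ho
  have := rv_mono w u v (List.suffix_of_suffix_length_le hv hu (by rw [hl]; exact h))
  omega

theorem card_zero (w : List A) :
    ((factors w).filter (fun u => rightValence w u = 0)).card + K w = w.length + 1 := by
  obtain ⟨hK, hs⟩ := K_spec w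
  have : (factors w).filter (fun u => rightValence w u = 0)
      = (Finset.range (w.length - K w + 1)).image (fun n => w.drop n) := by
    ext u
    simp only [Finset.mem_filter, mem_factors', Finset.mem_image, Finset.mem_range]
    constructor
    · rintro ⟨⟨s, t, e⟩, h0⟩
      have ht := (rv_zero w u).1 h0 s t e
      subst ht
      rw [List.append_nil] at e
      have hu : u <:+ w := ⟨s, e⟩
      have h1 := (hs u hu).1 h0
      have : s.length + u.length = w.length := by simp [← e]
      exact ⟨s.length, by omega, by simp [← e]⟩
    · rintro ⟨n, hn, rfl⟩
      refine ⟨(List.drop_suffix _ _).isInfix, (hs _ (List.drop_suffix _ _)).2 ?_⟩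
      rw [List.length_drop]; omega
  rw [this, Finset.card_image_of_injOn, Finset.card_range]
  · omega
  · intro a ha b hb h
    have := congrArg List.length h
    simp at this ha hb
    omega

theorem main_sum (w : List A) :
    ∑ u ∈ (factors w).filter (fun u => 2 ≤ rightValence w u), (rightValence w u - 1) + K w
      = w.length := by
  have h1 := sum_rv w
  have h2 := card_zero w
  have h3 : ∑ u ∈ factors w, rightValence w u
      + ((factors w).filter (fun u => rightValence w u = 0)).card =
      ∑ u ∈ (factors w).filter (fun u => 2 ≤ rightValence w u), (rightValence w u - 1)
      + (factors w).card := by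
    rw [Finset.card_filter, Finset.sum_filter, Finset.card_eq_sum_ones, ← Finset.sum_add_distrib,
      ← Finset.sum_add_distrib]
    apply Finset.sum_congr rfl
    intro u _
    split_ifs <;> omega
  omega

theorem R_spec (w : List A) : 0 < R w ∧ (∀ u, RightSpecial w u → u.length < R w) ∧
    ∀ i, 0 < i → i < R w → ∃ u, u.length = i ∧ RightSpecial w u := by
  have hne : {r : ℕ | 0 < r ∧ ∀ u : List A, u.length = r → ¬ RightSpecial w u}.Nonempty := by
    refine ⟨w.length + 1, by omega, fun u hu h => ?_⟩
    have := h.1.length_le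
    omega
  obtain ⟨h0, hR⟩ := Nat.sInf_mem hne
  refine ⟨h0, fun u hu => ?_, fun i hi hlt => ?_⟩
  · by_contra hc
    have hs := List.drop_suffix (u.length - R w) u
    refine hR (u.drop (u.length - R w)) ?_ ⟨hs.isInfix.trans hu.1, hu.2.trans (rv_mono _ _ _ hs)⟩
    rw [List.length_drop]
    change _ = R w
    omega
  · by_contra hc
    push Not at hc
    exact absurd (Nat.sInf_le (⟨hi, hc⟩ : i ∈ {r : ℕ | 0 < r ∧ ∀ u : List A, u.length = r → ¬ RightSpecial w u})) (by
      change ¬ (R w ≤ i); omega)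

theorem rv_nil (w : List A) : rightValence w [] = (Alph w).card := by
  unfold rightValence
  congr 1
  ext x
  rw [rv_mem]
  simp [Alph, List.singleton_infix_iff]

theorem stmt2 (w : List A) (h2 : 2 ≤ (Alph w).card) :
    w.length + 2 = R w + K w + (Alph w).card ↔
      ((∀ i : ℕ, i < R w → ∃! u : List A, u.length = i ∧ RightSpecial w u) ∧
       (∀ u : List A, u ≠ [] → RightSpecial w u → rightValence w u = 2)) := by
  have hsum := main_sum w
  obtain ⟨hR0, hRlt, hRex⟩ := R_spec w
  have hnil : RightSpecial w [] := ⟨List.nil_infix, by rw [rv_nil]; exact h2⟩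
  set S := (factors w).filter (fun u => 2 ≤ rightValence w u) with hS
  have hmS : ∀ u, u ∈ S ↔ RightSpecial w u := by
    intro u; rw [hS, Finset.mem_filter, mem_factors']; rfl
  rw [← Finset.add_sum_erase S _ ((hmS []).2 hnil), rv_nil] at hsum
  set T := S.erase [] with hT
  have hmT : ∀ u, u ∈ T ↔ u ≠ [] ∧ RightSpecial w u := by
    intro u; rw [hT, Finset.mem_erase, hmS]
  have himg : T.image List.length = Finset.Ico 1 (R w) := by
    ext i
    simp only [Finset.mem_image, hmT, Finset.mem_Ico]
    constructor
    · rintro ⟨u, ⟨hu, hr⟩, rfl⟩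
      exact ⟨List.length_pos_iff.2 hu, hRlt u hr⟩
    · rintro ⟨h1, h3⟩
      obtain ⟨u, rfl, hr⟩ := hRex i h1 h3
      exact ⟨u, ⟨List.length_pos_iff.1 h1, hr⟩, rfl⟩
  have hic : (T.image List.length).card = R w - 1 := by rw [himg, Nat.card_Ico]
  have hle1 : (T.image List.length).card ≤ T.card := Finset.card_image_le
  have hge : ∀ u ∈ T, 1 ≤ rightValence w u - 1 := by
    intro u hu
    have := ((hmT u).1 hu).2.2
    omega
  have hle2 : T.card ≤ ∑ u ∈ T, (rightValence w u - 1) := by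
    rw [Finset.card_eq_sum_ones]; exact Finset.sum_le_sum hge
  constructor
  · intro h
    have e1 : (T.image List.length).card = T.card := by omega
    have e2 : ∑ u ∈ T, 1 = ∑ u ∈ T, (rightValence w u - 1) := by
      rw [← Finset.card_eq_sum_ones]; omega
    rw [Finset.sum_eq_sum_iff_of_le hge] at e2
    rw [Finset.card_image_iff] at e1
    refine ⟨fun i hi => ?_, fun u hu hr => ?_⟩
    · rcases Nat.eq_zero_or_pos i with rfl | hp
      · exact ⟨[], ⟨rfl, hnil⟩, fun v hv => List.length_eq_zero_iff.1 hv.1⟩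
      · obtain ⟨u, hu, hr⟩ := hRex i hp hi
        refine ⟨u, ⟨hu, hr⟩, fun v hv => ?_⟩
        have hvT : v ∈ T := (hmT v).2 ⟨List.length_pos_iff.1 (by omega), hv.2⟩
        have huT : u ∈ T := (hmT u).2 ⟨List.length_pos_iff.1 (by omega), hr⟩
        exact e1 hvT huT (by rw [hu, hv.1])
    · have := e2 u ((hmT u).2 ⟨hu, hr⟩)
      omega
  · rintro ⟨ha, hb⟩
    have e1 : (T.image List.length).card = T.card := by
      rw [Finset.card_image_iff]
      intro u hu v hv huv
      have hu' := ((hmT u).1 hu).2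
      have hv' := ((hmT v).1 hv).2
      exact (ha u.length (hRlt u hu')).unique ⟨rfl, hu'⟩ ⟨huv.symm, hv'⟩
    have e2 : ∑ u ∈ T, (rightValence w u - 1) = T.card := by
      rw [Finset.card_eq_sum_ones]
      apply Finset.sum_congr rfl
      intro u hu
      rw [hb u ((hmT u).1 hu).1 ((hmT u).1 hu).2]
    omega
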